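/- For every prime power q there exists a real constant C_{q,3} > 0 such that: (i) there is an absolute constant C with |B₃(2n,q) − C_{q,3} · binom(n−1/2, n) · q^{2n}| ≤ C · q^{2n−1} / n^{3/2} for all positive integers n, and (ii) there is an absolute constant C′ with |C_{q,3} − 1| ≤ C′/q. -/

import Mathlib

/-- Generalized binomial coefficient `binom(x, n) = x(x-1)⋯(x-n+1)/n!` for real `x`. -/
noncomputable def rbinom (x : ℝ) (n : ℕ) : ℝ :=
  (∏ i ∈ Finset.range n, (x - (i : ℝ))) / (Nat.factorial n : ℝ)

open PowerSeries Finset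

/-- `f` has constant coefficient `1` and its logarithmic derivative `X * df / f` is `e`. -/
def HasLogDeriv (f e : PowerSeries ℝ) : Prop :=
  constantCoeff f = 1 ∧ X * derivative ℝ f = e * f

namespace HasLogDeriv

theorem coeff_X_mul_derivative (f : PowerSeries ℝ) (n : ℕ) :
    coeff n (X * derivative ℝ f) = n * coeff n f := by
  cases n with
  | zero => simp
  | succ n => rw [coeff_succ_X_mul, coeff_derivative]; push_cast; ring

theorem iff_coeff {f e : PowerSeries ℝ} : HasLogDeriv f e ↔ coeff 0 f = 1 ∧
    ∀ n : ℕ, n * coeff n f = ∑ p ∈ antidiagonal n, coeff p.1 e * coeff p.2 f := by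
  simp only [HasLogDeriv, PowerSeries.ext_iff, coeff_X_mul_derivative, coeff_mul _ e,
    coeff_zero_eq_constantCoeff]

theorem mul {f g e e' : PowerSeries ℝ} (hf : HasLogDeriv f e) (hg : HasLogDeriv g e') :
    HasLogDeriv (f * g) (e + e') := by
  refine ⟨by simp [hf.1, hg.1], ?_⟩
  rw [Derivation.leibniz, smul_eq_mul, smul_eq_mul]
  linear_combination f * hg.2 + g * hf.2

theorem one : HasLogDeriv 1 0 := ⟨by simp, by simp⟩

theorem prod {ι : Type*} (s : Finset ι) {f e : ι → PowerSeries ℝ}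
    (h : ∀ i ∈ s, HasLogDeriv (f i) (e i)) :
    HasLogDeriv (∏ i ∈ s, f i) (∑ i ∈ s, e i) := by
  classical
  induction s using Finset.induction_on with
  | empty => simpa using one
  | insert a s ha ih =>
    rw [prod_insert ha, sum_insert ha]
    exact (h a (mem_insert_self a s)).mul (ih fun i hi => h i (mem_insert_of_mem hi))

theorem coeff_zero {f e : PowerSeries ℝ} (hf : HasLogDeriv f e) : coeff 0 e = 0 := by
  have h := (iff_coeff.1 hf).2 0
  simpa [hf.1] using h.symm

theorem unique {f g e : PowerSeries ℝ} (hf : HasLogDeriv f e) (hg : HasLogDeriv g e) :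
    f = g := by
  ext n
  induction n using Nat.strong_induction_on with
  | _ n ih =>
    rcases Nat.eq_zero_or_pos n with rfl | hn
    · simp [hf.1, hg.1]
    · have h : (n : ℝ) * coeff n f = n * coeff n g := by
        rw [(iff_coeff.1 hf).2, (iff_coeff.1 hg).2]
        refine sum_congr rfl fun p hp => ?_
        rcases Nat.eq_zero_or_pos p.1 with h0 | h0
        · rw [h0, hf.coeff_zero, zero_mul, zero_mul]
        · rw [ih p.2 (by rw [HasAntidiagonal.mem_antidiagonal] at hp; omega)]
      exact mul_left_cancel₀ (by positivity) h

theorem exists_of_coeff_zero {e : PowerSeries ℝ} (he : coeff 0 e = 0) :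
    ∃ f, HasLogDeriv f e := by
  set g : PowerSeries ℝ := mk fun n => coeff n e / n with hg
  have hg0 : constantCoeff g = 0 := by
    rw [← coeff_zero_eq_constantCoeff_apply]; simp [hg]
  have hs : HasSubst g := HasSubst.of_constantCoeff_zero' hg0
  refine ⟨(exp ℝ).subst g, ?_, ?_⟩
  · have h := constantCoeff_subst_eq_zero hg0 (exp ℝ - 1) (by simp)
    rw [← coe_substAlgHom hs, map_sub, map_one, map_sub, map_one, coe_substAlgHom hs] at h
    exact sub_eq_zero.1 h
  · rw [derivative_subst hs]
    have : X * derivative ℝ g = e := by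
      ext n
      rw [coeff_X_mul_derivative, hg, coeff_mk]
      rcases Nat.eq_zero_or_pos n with rfl | hn
      · simp [he]
      · field_simp
    rw [← this, derivative_exp]
    ring

/-- Majorisation by `(1 - r X)⁻²`. -/
theorem abs_coeff_le {f e : PowerSeries ℝ} (hf : HasLogDeriv f e) {r : ℝ} (hr : 0 ≤ r)
    (he : ∀ k, |coeff k e| ≤ 2 * r ^ k) (n : ℕ) : |coeff n f| ≤ (n + 1) * r ^ n := by
  induction n using Nat.strong_induction_on with
  | _ n ih =>
    rcases Nat.eq_zero_or_pos n with rfl | hn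
    · simp [hf.1]
    · have key : (n : ℝ) * |coeff n f| ≤ n * ((n + 1) * r ^ n) := by
        obtain ⟨m, rfl⟩ : ∃ m, n = m + 1 := ⟨n - 1, by omega⟩
        rw [← Nat.abs_cast, ← abs_mul, (iff_coeff.1 hf).2, Nat.abs_cast,
          Nat.sum_antidiagonal_succ, hf.coeff_zero, zero_mul, zero_add]
        have hsum : ∀ m : ℕ, ∑ p ∈ antidiagonal m, 2 * ((p.2 : ℝ) + 1) = (m + 1) * (m + 2) := by
          intro m
          induction m with
          | zero => simp
          | succ m ihm =>
            rw [Nat.sum_antidiagonal_succ, ihm]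
            push_cast
            ring
        calc |∑ p ∈ antidiagonal m, coeff (p.1 + 1) e * coeff p.2 f|
            ≤ ∑ p ∈ antidiagonal m, |coeff (p.1 + 1) e * coeff p.2 f| := abs_sum_le_sum_abs _ _
          _ ≤ ∑ p ∈ antidiagonal m, r ^ (m + 1) * (2 * ((p.2 : ℝ) + 1)) := by
              refine sum_le_sum fun p hp => ?_
              rw [HasAntidiagonal.mem_antidiagonal] at hp
              rw [abs_mul, ← hp]
              calc |coeff (p.1 + 1) e| * |coeff p.2 f|
                  ≤ (2 * r ^ (p.1 + 1)) * ((p.2 + 1) * r ^ p.2) :=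
                    mul_le_mul (he _) (ih _ (by omega)) (abs_nonneg _) (by positivity)
                _ = _ := by ring
          _ = _ := by rw [← mul_sum, hsum]; push_cast; ring
      exact le_of_mul_le_mul_left key (by positivity)

theorem summable_norm {f e : PowerSeries ℝ} (hf : HasLogDeriv f e) {r : ℝ} (hr : 0 ≤ r)
    (hr1 : r < 1) (he : ∀ k, |coeff k e| ≤ 2 * r ^ k) : Summable fun n => ‖coeff n f‖ := by
  have h1 : Summable fun n : ℕ => ((n : ℝ) ^ 1 * r ^ n) :=
    summable_pow_mul_geometric_of_norm_lt_one 1 (by rwa [Real.norm_of_nonneg hr])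
  have h2 : Summable fun n : ℕ => r ^ n := summable_geometric_of_lt_one hr hr1
  refine Summable.of_nonneg_of_le (fun _ => norm_nonneg _) (fun n => ?_) (h1.add h2)
  rw [Real.norm_eq_abs]
  refine (hf.abs_coeff_le hr he n).trans_eq (by ring)

theorem tsum_mul {f g : PowerSeries ℝ} (hf : Summable fun n => ‖coeff n f‖)
    (hg : Summable fun n => ‖coeff n g‖) :
    ∑' n, coeff n (f * g) = (∑' n, coeff n f) * ∑' n, coeff n g := by
  rw [tsum_mul_tsum_eq_tsum_sum_antidiagonal_of_summable_norm hf hg]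
  simp only [coeff_mul]

theorem tsum_pos {f e : PowerSeries ℝ} (hf : HasLogDeriv f e) {r : ℝ} (hr : 0 ≤ r)
    (hr1 : r < 1) (he : ∀ k, |coeff k e| ≤ 2 * r ^ k) : 0 < ∑' n, coeff n f := by
  have h0 := hf.coeff_zero
  obtain ⟨g, hg⟩ := exists_of_coeff_zero (e := (1 / 2 : ℝ) • e)
    (by rw [coeff_smul, h0, smul_zero])
  obtain ⟨g', hg'⟩ := exists_of_coeff_zero (e := -((1 / 2 : ℝ) • e))
    (by rw [map_neg, coeff_smul, h0, smul_zero, neg_zero])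
  have hb : ∀ k, |coeff k ((1 / 2 : ℝ) • e)| ≤ 2 * r ^ k := fun k => by
    rw [coeff_smul, smul_eq_mul, abs_mul, abs_of_nonneg (by norm_num : (0 : ℝ) ≤ 1 / 2)]
    have := he k
    have := abs_nonneg (coeff k e)
    linarith
  have sg := hg.summable_norm hr hr1 hb
  have sg' := hg'.summable_norm hr hr1 fun k => by rw [map_neg, abs_neg]; exact hb k
  have hgg : g * g = f := by
    refine (hg.mul hg).unique ?_
    rwa [← add_smul, add_halves, one_smul]
  have hgg' : g * g' = 1 := by
    refine (hg.mul hg').unique ?_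
    rw [add_neg_cancel]; exact one
  have h1 : (∑' n, coeff n g) * ∑' n, coeff n g' = 1 := by
    rw [← tsum_mul sg sg', hgg']
    rw [tsum_eq_single 0 fun n hn => by simp [coeff_one, hn]]
    simp
  rw [← hgg, tsum_mul sg sg]
  exact mul_self_pos.2 (left_ne_zero_of_mul_eq_one h1)

end HasLogDeriv

theorem rbinom_half_zero : rbinom ((0 : ℕ) - 1 / 2 : ℝ) 0 = 1 := by simp [rbinom]

theorem rbinom_half_succ (n : ℕ) : rbinom ((n + 1 : ℕ) - 1 / 2 : ℝ) (n + 1) * (2 * (n + 1)) =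
    (2 * n + 1) * rbinom (n - 1 / 2 : ℝ) n := by
  have h : ∀ i : ℕ, ((n + 1 : ℕ) : ℝ) - 1 / 2 - (i + 1 : ℕ) = n - 1 / 2 - i := fun i => by
    push_cast; ring
  have hf : (n.factorial : ℝ) ≠ 0 := by positivity
  simp only [rbinom, prod_range_succ', h, Nat.factorial_succ]
  push_cast
  field_simp
  ring

theorem rbinom_half_pos (n : ℕ) : 0 < rbinom (n - 1 / 2 : ℝ) n := by
  induction n with
  | zero => rw [rbinom_half_zero]; exact one_pos
  | succ n ih =>
    have h : 0 < rbinom ((n + 1 : ℕ) - 1 / 2 : ℝ) (n + 1) * (2 * (n + 1)) := by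
      rw [rbinom_half_succ]; positivity
    exact pos_of_mul_pos_left h (by positivity)

theorem rbinom_half_sub_succ (n : ℕ) :
    rbinom (n - 1 / 2 : ℝ) n - rbinom ((n + 1 : ℕ) - 1 / 2 : ℝ) (n + 1) =
      rbinom (n - 1 / 2 : ℝ) n / (2 * (n + 1)) := by
  have := rbinom_half_succ n
  rw [eq_div_iff (by positivity)]
  linarith

theorem rbinom_half_sq_le (n : ℕ) : rbinom (n - 1 / 2 : ℝ) n ^ 2 * (2 * n + 1) ≤ 1 := by
  induction n with
  | zero => rw [rbinom_half_zero]; norm_num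
  | succ n ih =>
    have h : rbinom ((n + 1 : ℕ) - 1 / 2 : ℝ) (n + 1) =
        (2 * n + 1) * rbinom (n - 1 / 2 : ℝ) n / (2 * (n + 1)) := by
      rw [eq_div_iff (by positivity), rbinom_half_succ]
    rw [h, div_pow, div_mul_eq_mul_div, div_le_one (by positivity)]
    push_cast
    nlinarith [mul_le_mul_of_nonneg_right ih
      (by positivity : (0 : ℝ) ≤ (2 * n + 1) * (2 * (n + 1) + 1))]

theorem rbinom_half_sub_succ_le (n : ℕ) :
    rbinom (n - 1 / 2 : ℝ) n - rbinom ((n + 1 : ℕ) - 1 / 2 : ℝ) (n + 1) ≤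
      1 / ((n : ℝ) + 1) ^ (3 / 2 : ℝ) := by
  have hn : (0 : ℝ) < n + 1 := by positivity
  have h1 : rbinom (n - 1 / 2 : ℝ) n * √((n : ℝ) + 1) ≤ 1 := by
    rw [← abs_of_nonneg (mul_nonneg (rbinom_half_pos n).le (Real.sqrt_nonneg _)),
      ← sq_le_one_iff_abs_le_one, mul_pow, Real.sq_sqrt hn.le]
    refine le_trans ?_ (rbinom_half_sq_le n)
    gcongr
    linarith [(Nat.cast_nonneg n : (0 : ℝ) ≤ n)]
  have h2 : ((n : ℝ) + 1) ^ (3 / 2 : ℝ) = (n + 1) * √((n : ℝ) + 1) := by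
    rw [Real.sqrt_eq_rpow, ← Real.rpow_one_add' hn.le (by norm_num)]
    norm_num
  have h3 := Real.sqrt_pos.2 hn
  rw [rbinom_half_sub_succ, h2, div_le_div_iff₀ (by positivity) (by positivity)]
  nlinarith

theorem rbinom_half_antitone : Antitone fun n : ℕ => rbinom (n - 1 / 2 : ℝ) n := by
  refine antitone_nat_of_succ_le fun n => ?_
  have h := rbinom_half_sub_succ n
  have : 0 ≤ rbinom (n - 1 / 2 : ℝ) n / (2 * (n + 1)) :=
    div_nonneg (rbinom_half_pos n).le (by positivity)
  linarith

theorem rbinom_half_le_one (n : ℕ) : rbinom (n - 1 / 2 : ℝ) n ≤ 1 :=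
  (rbinom_half_antitone (Nat.zero_le n)).trans_eq rbinom_half_zero

theorem rbinom_half_sub_add_le (m j : ℕ) :
    rbinom (m - 1 / 2 : ℝ) m - rbinom ((m + j : ℕ) - 1 / 2 : ℝ) (m + j) ≤
      j / ((m : ℝ) + 1) ^ (3 / 2 : ℝ) := by
  induction j with
  | zero => simp
  | succ j ih =>
    have h1 := rbinom_half_sub_succ_le (m + j)
    have h2 : 1 / (((m + j : ℕ) : ℝ) + 1) ^ (3 / 2 : ℝ) ≤ 1 / ((m : ℝ) + 1) ^ (3 / 2 : ℝ) := by
      gcongr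
      linarith
    rw [Nat.cast_succ, add_div]
    rw [← add_assoc m j 1]
    linarith

/-- Coefficients of `(1 - X)^(-1/2)`, extended by zero to the left, vary slowly. -/
theorem abs_shift_rbinom_half_sub_le {n : ℕ} (hn : 0 < n) (j : ℕ) :
    |(if j ≤ n then rbinom ((n - j : ℕ) - 1 / 2 : ℝ) (n - j) else 0) - rbinom (n - 1 / 2 : ℝ) n| ≤
      j ^ 3 / (n : ℝ) ^ (3 / 2 : ℝ) := by
  have hn0 : (0 : ℝ) < n := by exact_mod_cast hn
  rcases Nat.eq_zero_or_pos j with rfl | hj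
  · simp
  have hj1 : (1 : ℝ) ≤ j := by exact_mod_cast hj
  have hpow : (j : ℝ) ^ (3 / 2 : ℝ) ≤ j ^ 2 := by
    rw [← Real.rpow_two]
    exact Real.rpow_le_rpow_of_exponent_le hj1 (by norm_num)
  split_ifs with h
  · obtain ⟨m, rfl⟩ := Nat.exists_eq_add_of_le' h
    rw [Nat.add_sub_cancel, abs_of_nonneg (sub_nonneg.2 (rbinom_half_antitone (by omega)))]
    refine (rbinom_half_sub_add_le m j).trans ?_
    have h1 : ((m + j : ℕ) : ℝ) ^ (3 / 2 : ℝ) ≤ j ^ 2 * ((m : ℝ) + 1) ^ (3 / 2 : ℝ) := by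
      calc ((m + j : ℕ) : ℝ) ^ (3 / 2 : ℝ) ≤ (j * ((m : ℝ) + 1)) ^ (3 / 2 : ℝ) := by
            gcongr
            push_cast
            nlinarith [(Nat.cast_nonneg m : (0 : ℝ) ≤ m)]
        _ = (j : ℝ) ^ (3 / 2 : ℝ) * ((m : ℝ) + 1) ^ (3 / 2 : ℝ) :=
            Real.mul_rpow (by positivity) (by positivity)
        _ ≤ _ := by gcongr
    rw [div_le_div_iff₀ (by positivity) (by positivity)]
    nlinarith
  · rw [zero_sub, abs_neg, abs_of_pos (rbinom_half_pos n)]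
    refine (rbinom_half_le_one n).trans ?_
    rw [one_le_div (by positivity)]
    calc (n : ℝ) ^ (3 / 2 : ℝ) ≤ (j : ℝ) ^ (3 / 2 : ℝ) := by
          gcongr
          omega
      _ ≤ j ^ 2 := hpow
      _ ≤ j ^ 3 := by gcongr; norm_num

/-- The series `X / (2 (1 - X))`, the logarithmic derivative of `(1 - X)^(-1/2)`. -/
noncomputable def halfGeom : PowerSeries ℝ := mk fun n => if n = 0 then 0 else 1 / 2

theorem hasLogDeriv_rbinom_half :
    HasLogDeriv (mk fun n => rbinom (n - 1 / 2 : ℝ) n) halfGeom := by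
  refine HasLogDeriv.iff_coeff.2 ⟨by rw [coeff_mk, rbinom_half_zero], fun n => ?_⟩
  simp only [halfGeom, coeff_mk]
  induction n with
  | zero => simp
  | succ n ih =>
    have h0 : ∀ n : ℕ, ∑ p ∈ antidiagonal n,
        (if p.1 + 1 = 0 then (0 : ℝ) else 1 / 2) * rbinom (p.2 - 1 / 2 : ℝ) p.2 =
        (∑ p ∈ antidiagonal n, (if p.1 = 0 then (0 : ℝ) else 1 / 2) * rbinom (p.2 - 1 / 2 : ℝ) p.2)
          + 1 / 2 * rbinom (n - 1 / 2 : ℝ) n := by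
      intro n
      cases n with
      | zero => simp
      | succ n =>
        rw [Nat.sum_antidiagonal_succ, Nat.sum_antidiagonal_succ]
        simp
        ring
    rw [Nat.sum_antidiagonal_succ, h0, ← ih]
    have := rbinom_half_succ n
    rw [if_pos rfl]
    push_cast at *
    linarith

/-- The weights `2 (j + 1) j ^ 3 / 2 ^ j` dominating the error terms. -/
noncomputable def errorWeight (j : ℕ) : ℝ := (j + 1) * j ^ 3 * (2 * (1 / 2) ^ j)

theorem errorWeight_nonneg (j : ℕ) : 0 ≤ errorWeight j := by
  unfold errorWeight; positivity

theorem summable_errorWeight : Summable errorWeight := by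
  have h (k : ℕ) : Summable fun n : ℕ => ((n : ℝ) ^ k * (1 / 2 : ℝ) ^ n) :=
    summable_pow_mul_geometric_of_norm_lt_one k (by norm_num)
  refine (((h 4).add (h 3)).mul_left 2).congr fun j => ?_
  rw [errorWeight]; ring

theorem HasLogDeriv.asymptotics {b e : PowerSeries ℝ} {r : ℝ} (hr : 0 ≤ r) (hr2 : r ≤ 1 / 2)
    (hb : HasLogDeriv b (e + halfGeom)) (he : ∀ k, |coeff k e| ≤ 2 * r ^ k) :
    ∃ c : ℝ, 0 < c ∧
      (∀ n : ℕ, 0 < n → |coeff n b - c * rbinom (n - 1 / 2 : ℝ) n| ≤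
        r * (∑' j, errorWeight j) / (n : ℝ) ^ (3 / 2 : ℝ)) ∧
      |c - 1| ≤ r * ∑' j, errorWeight j := by
  have hr1 : r < 1 := by linarith
  have h0 : coeff 0 e = 0 := by simpa [halfGeom] using hb.coeff_zero
  obtain ⟨f, hf⟩ := HasLogDeriv.exists_of_coeff_zero h0
  have hbf : b = f * mk fun n => rbinom (n - 1 / 2 : ℝ) n :=
    hb.unique (hf.mul hasLogDeriv_rbinom_half)
  have hs := hf.summable_norm hr hr1 he
  have hw : ∀ j, |coeff j f| * j ^ 3 ≤ r * errorWeight j := by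
    intro j
    rcases Nat.eq_zero_or_pos j with rfl | hj
    · simp [errorWeight]
    obtain ⟨i, rfl⟩ : ∃ i, j = i + 1 := ⟨j - 1, by omega⟩
    have hi : r ^ i ≤ (1 / 2) ^ i := pow_le_pow_left₀ hr hr2 i
    calc |coeff (i + 1) f| * ((i + 1 : ℕ) : ℝ) ^ 3
        ≤ (((i + 1 : ℕ) + 1) * r ^ (i + 1)) * ((i + 1 : ℕ) : ℝ) ^ 3 := by
          gcongr
          exact hf.abs_coeff_le hr he _
      _ = r * (((i + 1 : ℕ) + 1) * ((i + 1 : ℕ) : ℝ) ^ 3 * r ^ i) := by ring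
      _ ≤ r * (((i + 1 : ℕ) + 1) * ((i + 1 : ℕ) : ℝ) ^ 3 * (1 / 2) ^ i) := by gcongr
      _ = _ := by rw [errorWeight]; ring
  have hsum : HasSum (fun j => r * errorWeight j) (r * ∑' j, errorWeight j) :=
    summable_errorWeight.hasSum.mul_left r
  refine ⟨∑' n, coeff n f, hf.tsum_pos hr hr1 he, fun n hn => ?_, ?_⟩
  · have h1 : coeff n b = ∑' j, coeff j f *
        (if j ≤ n then rbinom ((n - j : ℕ) - 1 / 2 : ℝ) (n - j) else 0) := by
      rw [tsum_eq_sum (s := range (n + 1))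
        fun j hj => by rw [if_neg (by rw [mem_range] at hj; omega), mul_zero]]
      rw [hbf, coeff_mul, Nat.sum_antidiagonal_eq_sum_range_succ_mk]
      refine sum_congr rfl fun j hj => ?_
      rw [if_pos (by rw [mem_range] at hj; omega), coeff_mk]
    have hs1 : Summable fun j => coeff j f *
        (if j ≤ n then rbinom ((n - j : ℕ) - 1 / 2 : ℝ) (n - j) else 0) :=
      summable_of_ne_finset_zero (s := range (n + 1))
        fun j hj => by rw [if_neg (by rw [mem_range] at hj; omega), mul_zero]
    rw [h1, ← tsum_mul_right, ← hs1.tsum_sub ((Summable.of_norm hs).mul_right _)]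
    rw [← Real.norm_eq_abs]
    refine tsum_of_norm_bounded (hsum.div_const _) fun j => ?_
    rw [← mul_sub, Real.norm_eq_abs, abs_mul]
    calc _ ≤ |coeff j f| * (j ^ 3 / (n : ℝ) ^ (3 / 2 : ℝ)) := by
          gcongr
          exact abs_shift_rbinom_half_sub_le hn j
      _ = |coeff j f| * j ^ 3 / (n : ℝ) ^ (3 / 2 : ℝ) := by ring
      _ ≤ _ := div_le_div_of_nonneg_right (hw j) (by positivity)
  · rw [(Summable.of_norm hs).tsum_eq_zero_add, coeff_zero_eq_constantCoeff_apply, hf.1,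
      add_sub_cancel_left]
    have hle : ∀ j, ‖coeff (j + 1) f‖ ≤ r * errorWeight (j + 1) := fun j => by
      refine le_trans ?_ (hw (j + 1))
      rw [Real.norm_eq_abs]
      refine le_mul_of_one_le_right (abs_nonneg _) (one_le_pow₀ ?_)
      push_cast
      linarith [(Nat.cast_nonneg j : (0 : ℝ) ≤ j)]
    have hsum1 : Summable fun j => r * errorWeight (j + 1) :=
      (summable_nat_add_iff 1).2 hsum.summable
    have hbound := tsum_of_norm_bounded hsum1.hasSum hle
    rw [Real.norm_eq_abs] at hbound
    refine hbound.trans ?_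
    rw [← tsum_mul_left, hsum.summable.tsum_eq_zero_add]
    simp [errorWeight]

section FiniteField

open Polynomial UniqueFactorizationMonoid

theorem subset_of_prod_eq {K : Type*} [Field K] {s t : Finset K[X]}
    (hs : ∀ P ∈ s, P.Monic ∧ Irreducible P) (ht : ∀ P ∈ t, P.Monic ∧ Irreducible P)
    (h : ∏ P ∈ s, P = ∏ P ∈ t, P) : s ⊆ t := by
  intro P hP
  have hdvd : P ∣ ∏ Q ∈ t, Q := h ▸ dvd_prod_of_mem _ hP
  obtain ⟨Q, hQ, hPQ⟩ := (hs P hP).2.prime.exists_mem_finset_dvd hdvd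
  have := eq_of_monic_of_associated (hs P hP).1 (ht Q hQ).1
    ((hs P hP).2.associated_of_dvd (ht Q hQ).2 hPQ)
  rwa [this]

variable (F : Type) [Field F] [Fintype F]

open scoped Classical in
/-- The monic irreducible polynomials of degree `d ≠ 0` over a finite field. -/
noncomputable def monicIrreducibles (d : ℕ) : Finset F[X] :=
  {P ∈ (normalizedFactors (Polynomial.X ^ (Fintype.card F) ^ d - Polynomial.X : F[X])).toFinset |
    P.natDegree = d}

variable {F}

theorem mem_normalizedFactors_X_pow_card_pow_sub_X [DecidableEq F] {n : ℕ} (hn : n ≠ 0) {P : F[X]} :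
    P ∈ normalizedFactors (Polynomial.X ^ (Fintype.card F) ^ n - Polynomial.X : F[X]) ↔
      P.Monic ∧ Irreducible P ∧ P.natDegree ∣ n := by
  rw [mem_normalizedFactors_iff'
    (FiniteField.X_pow_card_pow_sub_X_ne_zero F hn Fintype.one_lt_card)]
  constructor
  · rintro ⟨h1, h2, h3⟩
    rw [← Nat.card_eq_fintype_card] at h3
    exact ⟨h2 ▸ monic_normalize h1.ne_zero, h1, h1.natDegree_dvd_of_dvd_X_pow_card_pow_sub_X h3⟩
  · rintro ⟨h1, h2, h3⟩
    rw [h2.natDegree_dvd_iff_dvd_X_pow_card_pow_sub_X, Nat.card_eq_fintype_card] at h3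
    exact ⟨h2, h1.normalize_eq_self, h3⟩

theorem mem_monicIrreducibles {d : ℕ} (hd : d ≠ 0) {P : F[X]} :
    P ∈ monicIrreducibles F d ↔ P.Monic ∧ Irreducible P ∧ P.natDegree = d := by
  classical
  rw [monicIrreducibles, mem_filter, Multiset.mem_toFinset]
  have h := mem_normalizedFactors_X_pow_card_pow_sub_X hd (P := P)
  constructor
  · rintro ⟨h1, h2⟩
    have h3 := h.1 (by convert h1)
    exact ⟨h3.1, h3.2.1, h2⟩
  · rintro ⟨h1, h2, h3⟩
    refine ⟨?_, h3⟩
    convert h.2 ⟨h1, h2, h3.dvd⟩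

/-- Gauss's formula counting monic irreducible polynomials over a finite field. -/
theorem sum_divisors_mul_card_monicIrreducibles {n : ℕ} (hn : n ≠ 0) :
    ∑ d ∈ n.divisors, d * #(monicIrreducibles F d) = Fintype.card F ^ n := by
  classical
  set Q : F[X] := Polynomial.X ^ (Fintype.card F) ^ n - Polynomial.X with hQ
  have hQ0 : Q ≠ 0 := FiniteField.X_pow_card_pow_sub_X_ne_zero F hn Fintype.one_lt_card
  have hmem (P : F[X]) : P ∈ (normalizedFactors Q).toFinset ↔
      P.Monic ∧ Irreducible P ∧ P.natDegree ∣ n := by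
    rw [Multiset.mem_toFinset]; exact mem_normalizedFactors_X_pow_card_pow_sub_X hn
  have hsep : Q.Separable := by
    obtain ⟨p, hp⟩ := CharP.exists F
    refine galois_poly_separable p _ (dvd_pow ?_ hn)
    exact (CharP.cast_eq_zero_iff F p _).1 (FiniteField.cast_card_eq_zero F)
  have hnodup := (squarefree_iff_nodup_normalizedFactors hQ0).1 hsep.squarefree
  have hdeg : Q.natDegree = ∑ P ∈ (normalizedFactors Q).toFinset, P.natDegree := by
    rw [← natDegree_eq_of_degree_eq (degree_eq_degree_of_associated (prod_normalizedFactors hQ0)),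
      natDegree_multiset_prod_of_monic _ fun P hP => ((hmem P).1 (Multiset.mem_toFinset.2 hP)).1,
      sum_eq_multiset_sum, Multiset.toFinset_val, hnodup.dedup]
  rw [hQ, FiniteField.X_pow_card_pow_sub_X_natDegree_eq F hn Fintype.one_lt_card] at hdeg
  rw [hdeg, ← sum_fiberwise_of_maps_to (t := n.divisors) (g := natDegree)
    fun P hP => Nat.mem_divisors.2 ⟨((hmem P).1 hP).2.2, hn⟩]
  refine sum_congr rfl fun d hd => ?_
  have hd0 : d ≠ 0 := (Nat.pos_of_mem_divisors hd).ne'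
  rw [sum_congr rfl fun P hP => (mem_filter.1 hP).2, sum_const, smul_eq_mul, mul_comm]
  congr 2
  ext P
  rw [mem_monicIrreducibles hd0, mem_filter, hmem]
  refine ⟨fun h => ⟨⟨h.1, h.2.1, ?_⟩, h.2.2⟩, fun h => ⟨h.1.1, h.1.2.1, h.2⟩⟩
  rw [h.2.2]
  exact Nat.dvd_of_mem_divisors hd

theorem mul_card_monicIrreducibles_le {d : ℕ} (hd : d ≠ 0) :
    d * #(monicIrreducibles F d) ≤ Fintype.card F ^ d := by
  rw [← sum_divisors_mul_card_monicIrreducibles hd]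
  exact single_le_sum (f := fun d => d * #(monicIrreducibles F d)) (fun _ _ => Nat.zero_le _)
    (Nat.mem_divisors_self d hd)

theorem sum_range_succ_pow_le {q : ℕ} (hq : 2 ≤ q) (n : ℕ) :
    ∑ d ∈ range (n + 1), q ^ d ≤ 2 * q ^ n := by
  induction n with
  | zero => simp
  | succ n ih =>
    rw [sum_range_succ, pow_succ]
    nlinarith [Nat.mul_le_mul_left (q ^ n) hq]

variable (F) in
/-- Coefficients of the logarithmic derivative of `∏ (1 + X ^ (deg P / 2))`, the product running
over monic irreducible polynomials `P` of even degree. -/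
noncomputable def evenLogDerivCoeff (n : ℕ) : ℝ :=
  ∑ k ∈ n.divisors, (-1) ^ (n / k - 1) * (k * #(monicIrreducibles F (2 * k)) : ℝ)

theorem abs_evenLogDerivCoeff_sub_le {n : ℕ} (hn : n ≠ 0) :
    |evenLogDerivCoeff F n - (Fintype.card F : ℝ) ^ (2 * n) / 2| ≤
      2 * (Fintype.card F : ℝ) ^ n := by
  set q := Fintype.card F with hq
  have hq2 : 2 ≤ q := Fintype.one_lt_card
  have hgauss := sum_divisors_mul_card_monicIrreducibles (F := F) (n := 2 * n) (by omega)
  rw [← Nat.cons_self_properDivisors (by omega), sum_cons] at hgauss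
  have h1 : ∑ d ∈ (2 * n).properDivisors, d * #(monicIrreducibles F d) ≤ 2 * q ^ n := by
    refine le_trans ?_ (sum_range_succ_pow_le hq2 n)
    refine (sum_le_sum fun d hd => mul_card_monicIrreducibles_le (F := F)
      (Nat.pos_of_mem_properDivisors hd).ne').trans ?_
    refine sum_le_sum_of_subset fun d hd => ?_
    obtain ⟨⟨k, hk⟩, hlt⟩ := Nat.mem_properDivisors.1 hd
    rw [mem_range]
    have : 2 ≤ k := by
      by_contra! h
      interval_cases k <;> omega
    nlinarith
  have h2 : ∑ k ∈ n.properDivisors, 2 * (k * #(monicIrreducibles F (2 * k))) ≤ 2 * q ^ n := by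
    refine le_trans ?_ (sum_range_succ_pow_le hq2 n)
    calc ∑ k ∈ n.properDivisors, 2 * (k * #(monicIrreducibles F (2 * k)))
        ≤ ∑ k ∈ n.properDivisors, q ^ (2 * k) := by
          refine sum_le_sum fun k hk => ?_
          have := Nat.pos_of_mem_properDivisors hk
          rw [← mul_assoc]
          exact mul_card_monicIrreducibles_le (by omega)
      _ = ∑ d ∈ n.properDivisors.image (2 * ·), q ^ d :=
          (sum_image fun a _ b _ h => by simpa using h).symm
      _ ≤ _ := by
          refine sum_le_sum_of_subset fun d hd => ?_
          obtain ⟨k, hk, rfl⟩ := mem_image.1 hd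
          obtain ⟨⟨j, hj⟩, hlt⟩ := Nat.mem_properDivisors.1 hk
          rw [mem_range]
          have : 2 ≤ j := by
            by_contra! h
            interval_cases j <;> omega
          nlinarith
  have h3 : |∑ k ∈ n.properDivisors,
      (-1) ^ (n / k - 1) * (k * #(monicIrreducibles F (2 * k)) : ℝ)| ≤
      ∑ k ∈ n.properDivisors, (k * #(monicIrreducibles F (2 * k)) : ℝ) := by
    refine (abs_sum_le_sum_abs _ _).trans_eq (sum_congr rfl fun k _ => ?_)
    rw [abs_mul, abs_pow, abs_neg, abs_one, one_pow, one_mul, abs_of_nonneg (by positivity)]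
  rw [← mul_sum] at h2
  rw [evenLogDerivCoeff, ← Nat.cons_self_properDivisors hn, sum_cons,
    Nat.div_self (Nat.pos_of_ne_zero hn), Nat.sub_self, pow_zero, one_mul]
  have hgauss' : (_ : ℝ) = _ := congrArg (Nat.cast (R := ℝ)) hgauss
  have h1' : (_ : ℝ) ≤ _ := Nat.cast_le (α := ℝ).2 h1
  have h2' : (_ : ℝ) ≤ _ := Nat.cast_le (α := ℝ).2 h2
  have h4 : (0 : ℝ) ≤ ((∑ d ∈ (2 * n).properDivisors, d * #(monicIrreducibles F d) : ℕ) : ℝ) :=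
    Nat.cast_nonneg _
  push_cast at hgauss' h1' h2' h4
  rw [abs_le] at h3 ⊢
  constructor <;> linarith

/-- Logarithmic derivative of `1 + X ^ k`. -/
noncomputable def oneAddXPowLogDeriv (k : ℕ) : PowerSeries ℝ :=
  PowerSeries.mk fun n => if n ≠ 0 ∧ k ∣ n then (-1) ^ (n / k - 1) * k else 0

theorem hasLogDeriv_one_add_X_pow {k : ℕ} (hk : k ≠ 0) :
    HasLogDeriv (1 + (PowerSeries.X : PowerSeries ℝ) ^ k) (oneAddXPowLogDeriv k) := by
  refine ⟨by simp [hk], ?_⟩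
  ext n
  rw [HasLogDeriv.coeff_X_mul_derivative, mul_add, mul_one, map_add, map_add,
    PowerSeries.coeff_mul_X_pow', PowerSeries.coeff_X_pow, PowerSeries.coeff_one]
  simp only [oneAddXPowLogDeriv, PowerSeries.coeff_mk]
  by_cases hdvd : k ∣ n
  · obtain ⟨m, rfl⟩ := hdvd
    rcases m with _ | _ | m
    · simp [hk]
    · simp [hk, Nat.div_self (Nat.pos_of_ne_zero hk)]
    · have e1 : k * (m + 1 + 1) - k = k * (m + 1) := by
        rw [Nat.mul_succ k (m + 1), Nat.add_sub_cancel]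
      have e2 : k ≤ k * (m + 1 + 1) := Nat.le_mul_of_pos_right k (by omega)
      have e3 : k * (m + 1 + 1) ≠ k := by
        intro h
        have := Nat.eq_of_mul_eq_mul_left (Nat.pos_of_ne_zero hk) (h.trans (mul_one k).symm)
        omega
      have e4 : k * (m + 1 + 1) ≠ 0 := by positivity
      have e5 : k * (m + 1) ≠ 0 := by positivity
      rw [e1, if_pos e2, if_neg e3, if_neg e4, if_pos ⟨e4, dvd_mul_right _ _⟩,
        if_pos ⟨e5, dvd_mul_right _ _⟩, Nat.mul_div_cancel_left _ (Nat.pos_of_ne_zero hk),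
        Nat.mul_div_cancel_left _ (Nat.pos_of_ne_zero hk)]
      simp only [Nat.add_sub_cancel]
      ring
  · have e1 : n ≠ k := by rintro rfl; exact hdvd dvd_rfl
    have e2 : n ≠ 0 := by rintro rfl; exact hdvd (dvd_zero k)
    rw [if_neg e1, if_neg e2, if_neg (fun h => hdvd h.2)]
    split_ifs with h1 h2
    · exact absurd ((Nat.dvd_sub_iff_left h1 dvd_rfl).1 h2.2) hdvd
    · simp
    · simp

theorem HasLogDeriv.rescale {f e : PowerSeries ℝ} (hf : HasLogDeriv f e) (a : ℝ) :
    HasLogDeriv (PowerSeries.rescale a f) (PowerSeries.rescale a e) := by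
  obtain ⟨h0, h⟩ := HasLogDeriv.iff_coeff.1 hf
  refine HasLogDeriv.iff_coeff.2 ⟨by rw [PowerSeries.coeff_rescale, h0, pow_zero, one_mul],
    fun n => ?_⟩
  rw [PowerSeries.coeff_rescale, mul_left_comm, h, mul_sum]
  refine sum_congr rfl fun p hp => ?_
  rw [HasAntidiagonal.mem_antidiagonal] at hp
  rw [PowerSeries.coeff_rescale, PowerSeries.coeff_rescale, ← hp, pow_add]
  ring

variable (F) in
/-- The monic irreducible polynomials of even degree at most `2 * N`. -/
noncomputable def evenMonicIrreducibles [DecidableEq F[X]] (N : ℕ) : Finset F[X] :=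
  (Icc 1 N).biUnion fun k => monicIrreducibles F (2 * k)

theorem mem_evenMonicIrreducibles [DecidableEq F[X]] {N : ℕ} {P : F[X]} :
    P ∈ evenMonicIrreducibles F N ↔
      P.Monic ∧ Irreducible P ∧ Even P.natDegree ∧ P.natDegree ≤ 2 * N := by
  simp only [evenMonicIrreducibles, mem_biUnion, mem_Icc]
  constructor
  · rintro ⟨k, hk, hP⟩
    obtain ⟨h1, h2, h3⟩ := (mem_monicIrreducibles (by omega)).1 hP
    exact ⟨h1, h2, by rw [h3]; exact even_two_mul k, by omega⟩
  · rintro ⟨h1, h2, ⟨k, hk⟩, h4⟩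
    have := h2.natDegree_pos
    exact ⟨k, by omega, (mem_monicIrreducibles (by omega)).2 ⟨h1, h2, by omega⟩⟩

variable (F) in
/-- The squarefree monic polynomials of degree `2 * n` all of whose monic irreducible factors have
even degree. -/
def squarefreeEven (n : ℕ) : Set F[X] :=
  {f | f.Monic ∧ Squarefree f ∧ f.natDegree = 2 * n ∧
    ∀ P : F[X], P.Monic → Irreducible P → P ∣ f → Even P.natDegree}

theorem card_squarefreeEven [DecidableEq F[X]] {n N : ℕ} (hnN : n ≤ N) :
    Nat.card (squarefreeEven F n) =
      #{t ∈ (evenMonicIrreducibles F N).powerset | ∑ P ∈ t, P.natDegree / 2 = n} := by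
  classical
  rw [Nat.card_coe_set_eq, ← Set.ncard_coe_finset]
  have hprop : ∀ t ∈ {t ∈ (evenMonicIrreducibles F N).powerset | ∑ P ∈ t, P.natDegree / 2 = n},
      ∀ P ∈ t, P.Monic ∧ Irreducible P ∧ Even P.natDegree ∧ P.natDegree ≤ 2 * N :=
    fun t ht P hP => mem_evenMonicIrreducibles.1 (mem_powerset.1 (mem_filter.1 ht).1 hP)
  rw [← Set.InjOn.ncard_image (f := fun t : Finset F[X] => ∏ P ∈ t, P)]
  · congr 1
    ext f
    simp only [Set.mem_image, mem_coe]
    constructor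
    · rintro ⟨h1, h2, h3, h4⟩
      have hnodup := (squarefree_iff_nodup_normalizedFactors h1.ne_zero).1 h2
      have hmem (P : F[X]) : P ∈ (normalizedFactors f).toFinset ↔
          P.Monic ∧ Irreducible P ∧ P ∣ f := by
        rw [Multiset.mem_toFinset, mem_normalizedFactors_iff' h1.ne_zero]
        exact ⟨fun h => ⟨h.2.1 ▸ monic_normalize h.1.ne_zero, h.1, h.2.2⟩,
          fun h => ⟨h.2.1, h.1.normalize_eq_self, h.2.2⟩⟩
      have hprod : ∏ P ∈ (normalizedFactors f).toFinset, P = f := by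
        rw [prod_eq_multiset_prod, Multiset.toFinset_val, hnodup.dedup, Multiset.map_id',
          prod_normalizedFactors_eq h1.ne_zero, h1.normalize_eq_self]
      refine ⟨(normalizedFactors f).toFinset, mem_filter.2 ⟨mem_powerset.2 fun P hP => ?_, ?_⟩,
        hprod⟩
      · obtain ⟨hm, hi, hd⟩ := (hmem P).1 hP
        refine mem_evenMonicIrreducibles.2 ⟨hm, hi, h4 P hm hi hd, ?_⟩
        have := natDegree_le_of_dvd hd h1.ne_zero
        omega
      · have hdeg := natDegree_prod_of_monic (normalizedFactors f).toFinset (fun P => P)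
          fun P hP => ((hmem P).1 hP).1
        rw [hprod, h3] at hdeg
        have h5 : ∑ P ∈ (normalizedFactors f).toFinset, P.natDegree =
            2 * ∑ P ∈ (normalizedFactors f).toFinset, P.natDegree / 2 := by
          rw [mul_sum]
          refine sum_congr rfl fun P hP => ?_
          obtain ⟨hm, hi, hd⟩ := (hmem P).1 hP
          exact (Nat.two_mul_div_two_of_even (h4 P hm hi hd)).symm
        omega
    · rintro ⟨t, ht, rfl⟩
      have hp := hprop t ht
      refine ⟨monic_prod_of_monic _ _ fun P hP => (hp P hP).1, ?_, ?_, fun Q hQm hQi hQ => ?_⟩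
      · refine squarefree_prod_of_pairwise_isCoprime (fun P hP Q hQ hPQ => ?_)
          fun P hP => (hp P hP).2.1.squarefree
        refine ((hp P hP).2.1.coprime_iff_not_dvd.2 fun hdvd => hPQ ?_).isRelPrime
        exact eq_of_monic_of_associated (hp P hP).1 (hp Q hQ).1
          ((hp P hP).2.1.associated_of_dvd (hp Q hQ).2.1 hdvd)
      · rw [natDegree_prod_of_monic _ _ fun P hP => (hp P hP).1, ← (mem_filter.1 ht).2, mul_sum]
        exact sum_congr rfl fun P hP => (Nat.two_mul_div_two_of_even (hp P hP).2.2.1).symm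
      · obtain ⟨P, hP, hdvd⟩ := hQi.prime.exists_mem_finset_dvd hQ
        rw [eq_of_monic_of_associated hQm (hp P hP).1
          (hQi.associated_of_dvd (hp P hP).2.1 hdvd)]
        exact (hp P hP).2.2.1
  · intro s hs t ht hst
    have hs' := fun P hP => And.intro (hprop s hs P hP).1 (hprop s hs P hP).2.1
    have ht' := fun P hP => And.intro (hprop t ht P hP).1 (hprop t ht P hP).2.1
    exact (subset_of_prod_eq hs' ht' hst).antisymm (subset_of_prod_eq ht' hs' hst.symm)

theorem coeff_prod_one_add_X_pow {ι : Type*} [DecidableEq ι] (s : Finset ι) (w : ι → ℕ) (n : ℕ) :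
    PowerSeries.coeff n (∏ i ∈ s, (1 + (PowerSeries.X : PowerSeries ℝ) ^ w i)) =
      (#{t ∈ s.powerset | ∑ i ∈ t, w i = n} : ℝ) := by
  rw [prod_one_add, map_sum]
  simp only [prod_pow_eq_pow_sum, PowerSeries.coeff_X_pow]
  simp [eq_comm]

theorem coeff_sum_oneAddXPowLogDeriv [DecidableEq F[X]] {n N : ℕ} (hnN : n ≤ N) :
    PowerSeries.coeff n (∑ P ∈ evenMonicIrreducibles F N, oneAddXPowLogDeriv (P.natDegree / 2)) =
      evenLogDerivCoeff F n := by
  rw [evenMonicIrreducibles, sum_biUnion, map_sum]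
  · have h : ∀ k ∈ Icc 1 N, PowerSeries.coeff n
        (∑ P ∈ monicIrreducibles F (2 * k), oneAddXPowLogDeriv (P.natDegree / 2)) =
        if k ∈ n.divisors then (-1) ^ (n / k - 1) * (k * #(monicIrreducibles F (2 * k)) : ℝ)
          else 0 := by
      intro k hk
      have hk0 : 2 * k ≠ 0 := by have := (mem_Icc.1 hk).1; omega
      have h2 : ∀ P ∈ monicIrreducibles F (2 * k),
          oneAddXPowLogDeriv (P.natDegree / 2) = oneAddXPowLogDeriv k := fun P hP => by
        rw [((mem_monicIrreducibles hk0).1 hP).2.2, Nat.mul_div_cancel_left _ two_pos]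
      rw [sum_congr rfl h2, sum_const, map_nsmul, nsmul_eq_mul, oneAddXPowLogDeriv,
        PowerSeries.coeff_mk]
      simp only [Nat.mem_divisors, and_comm (a := k ∣ n)]
      split_ifs
      · ring
      · simp
    rw [sum_congr rfl h, evenLogDerivCoeff, ← sum_filter]
    refine sum_congr ?_ fun _ _ => rfl
    ext k
    rw [mem_filter, mem_Icc]
    refine ⟨fun h => h.2, fun h => ⟨⟨Nat.pos_of_mem_divisors h, ?_⟩, h⟩⟩
    exact (Nat.divisor_le h).trans hnN
  · intro k hk l hl hkl
    refine disjoint_left.2 fun P hP hP' => hkl ?_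
    have hk1 := (mem_Icc.1 (mem_coe.1 hk)).1
    have hl1 := (mem_Icc.1 (mem_coe.1 hl)).1
    have := ((mem_monicIrreducibles (by omega)).1 hP).2.2
    have := ((mem_monicIrreducibles (by omega)).1 hP').2.2
    omega

variable (F) in
theorem hasLogDeriv_card_squarefreeEven :
    HasLogDeriv (PowerSeries.mk fun n => (Nat.card (squarefreeEven F n) : ℝ))
      (PowerSeries.mk (evenLogDerivCoeff F)) := by
  classical
  have hN (N : ℕ) := HasLogDeriv.prod (evenMonicIrreducibles F N)
    (f := fun P => 1 + PowerSeries.X ^ (P.natDegree / 2))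
    (e := fun P => oneAddXPowLogDeriv (P.natDegree / 2)) fun P hP => by
      obtain ⟨h1, h2, h3, h4⟩ := mem_evenMonicIrreducibles.1 hP
      have := h2.natDegree_pos
      obtain ⟨k, hk⟩ := h3
      exact hasLogDeriv_one_add_X_pow (by omega)
  have hcoeff {n N : ℕ} (h : n ≤ N) : PowerSeries.coeff n
      (∏ P ∈ evenMonicIrreducibles F N, (1 + PowerSeries.X ^ (P.natDegree / 2))) =
      (Nat.card (squarefreeEven F n) : ℝ) := by
    rw [coeff_prod_one_add_X_pow, card_squarefreeEven h]
  refine HasLogDeriv.iff_coeff.2 ⟨?_, fun n => ?_⟩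
  · rw [PowerSeries.coeff_mk, ← hcoeff le_rfl]
    exact (HasLogDeriv.iff_coeff.1 (hN 0)).1
  · have h := (HasLogDeriv.iff_coeff.1 (hN n)).2 n
    rw [hcoeff le_rfl] at h
    rw [PowerSeries.coeff_mk, h]
    refine sum_congr rfl fun p hp => ?_
    rw [HasAntidiagonal.mem_antidiagonal] at hp
    rw [hcoeff (by omega), coeff_sum_oneAddXPowLogDeriv (by omega), PowerSeries.coeff_mk,
      PowerSeries.coeff_mk]

end FiniteField

/-- For every prime power `q` (i.e. every finite field `F` with `q = card F`) there is a constant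
`C_{q,3} > 0` such that `B₃(2n, q)`, the number of squarefree monic polynomials of degree `2n`
all of whose monic irreducible factors have even degree, satisfies
`|B₃(2n,q) − C_{q,3} · binom(n − 1/2, n) · q^{2n}| ≤ C · q^{2n−1}/n^{3/2}` for all `n ≥ 1`,
and `|C_{q,3} − 1| ≤ C′/q`, where `C` and `C′` are absolute constants. -/
theorem landau_even_degree_factors_squarefree :
    ∃ C C' : ℝ, 0 < C ∧ 0 < C' ∧
      ∀ (F : Type) [Field F] [Fintype F],
        ∃ Cq3 : ℝ, 0 < Cq3 ∧
          (∀ n : ℕ, 0 < n →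
            |(Nat.card {f : Polynomial F // f.Monic ∧ Squarefree f ∧ f.natDegree = 2 * n ∧
                  ∀ P : Polynomial F, P.Monic → Irreducible P → P ∣ f → Even P.natDegree} : ℝ) -
                Cq3 * rbinom ((n : ℝ) - 1 / 2) n * (Fintype.card F : ℝ) ^ (2 * n)| ≤
              C * (Fintype.card F : ℝ) ^ (2 * n - 1) / (n : ℝ) ^ ((3 : ℝ) / 2)) ∧
          |Cq3 - 1| ≤ C' / (Fintype.card F : ℝ) := by
  have hK : 0 < ∑' j, errorWeight j :=
    summable_errorWeight.tsum_pos errorWeight_nonneg 1 (by norm_num [errorWeight])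
  refine ⟨_, _, hK, hK, fun F _ _ => ?_⟩
  set q : ℝ := (Fintype.card F : ℝ) with hq
  have hq2 : (2 : ℝ) ≤ q := Nat.ofNat_le_cast.2 (Fintype.one_lt_card : 1 < Fintype.card F)
  have hq0 : 0 < q := by linarith
  have hlog := (hasLogDeriv_card_squarefreeEven F).rescale (q ^ 2)⁻¹
  rw [← sub_add_cancel (rescale (q ^ 2)⁻¹ (PowerSeries.mk (evenLogDerivCoeff F))) halfGeom] at hlog
  obtain ⟨c, hc0, hc, hc1⟩ := hlog.asymptotics (r := q⁻¹) (by positivity)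
    (by rw [one_div]; exact inv_anti₀ two_pos hq2) fun k => by
      rw [map_sub, coeff_rescale, coeff_mk, halfGeom, coeff_mk]
      rcases Nat.eq_zero_or_pos k with rfl | hk
      · simp [evenLogDerivCoeff]
      rw [if_neg hk.ne']
      have h := abs_evenLogDerivCoeff_sub_le (F := F) hk.ne'
      have h1 : (q ^ 2)⁻¹ ^ k * evenLogDerivCoeff F k - 1 / 2 =
          (evenLogDerivCoeff F k - q ^ (2 * k) / 2) / q ^ (2 * k) := by
        rw [inv_pow, ← pow_mul]
        field_simp
      rw [h1, abs_div, abs_of_pos (by positivity : 0 < q ^ (2 * k)), div_le_iff₀ (by positivity)]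
      refine h.trans_eq ?_
      rw [inv_pow, two_mul k, pow_add, ← hq]
      field_simp
  refine ⟨c, hc0, fun n hn => ?_, by rwa [inv_mul_eq_div] at hc1⟩
  have h := hc n hn
  rw [coeff_rescale, coeff_mk] at h
  change |(Nat.card (squarefreeEven F n) : ℝ) - _| ≤ _
  have h1 : (Nat.card (squarefreeEven F n) : ℝ) - c * rbinom ((n : ℝ) - 1 / 2) n * q ^ (2 * n) =
      ((q ^ 2)⁻¹ ^ n * (Nat.card (squarefreeEven F n) : ℝ) - c * rbinom ((n : ℝ) - 1 / 2) n) *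
        q ^ (2 * n) := by
    rw [inv_pow, ← pow_mul]
    field_simp
  have h2 : q ^ (2 * n) = q ^ (2 * n - 1) * q := by
    rw [← pow_succ, Nat.sub_add_cancel (by omega)]
  rw [h1, abs_mul, abs_of_pos (by positivity : 0 < q ^ (2 * n))]
  refine (mul_le_mul_of_nonneg_right h (by positivity)).trans_eq ?_
  rw [h2]
  field_simp
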